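/- For a composition μ set f̂*_μ := q^{|μ|} · f*_μ(x_1/q,…,x_n/q) ∈ 𝒫_n. Then for every 1 ≤ i ≤ n−1: if μ_i > μ_{i+1} then T_i f̂*_μ = f̂*_{s_i·μ}; if μ_i = μ_{i+1} then T_i f̂*_μ = t f̂*_μ; and if μ_i < μ_{i+1} then T_i f̂*_μ = t f̂*_{s_i·μ} − (1−t) f̂*_μ. -/

import Mathlib

open MvPolynomial

noncomputable section
open scoped Classical

/-- The field `K = ℚ(q,t)`. -/
abbrev K : Type := FractionRing (MvPolynomial (Fin 2) ℚ)

/-- The indeterminate `q` as an element of `K`. -/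
def qq : K := algebraMap (MvPolynomial (Fin 2) ℚ) K (X 0)

/-- The indeterminate `t` as an element of `K`. -/
def tt : K := algebraMap (MvPolynomial (Fin 2) ℚ) K (X 1)

/-- The size `|ν|` of a composition. -/
def csize {n : ℕ} (ν : Fin n → ℕ) : ℕ := ∑ i, ν i

/-- `k_i(ν) = #{j < i : ν_j > ν_i} + #{j > i : ν_j ≥ ν_i}`. -/
def kstat {n : ℕ} (ν : Fin n → ℕ) (i : Fin n) : ℕ :=
  Set.ncard {j : Fin n | j < i ∧ ν i < ν j} + Set.ncard {j : Fin n | i < j ∧ ν i ≤ ν j}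

/-- The evaluation point `ν̃ = (q^{ν_i} t^{-k_i(ν)})_i`. -/
def evalPt {n : ℕ} (ν : Fin n → ℕ) : Fin n → K :=
  fun i => qq ^ ν i * tt ^ (-(kstat ν i : ℤ))

/-- Weakly decreasing composition. -/
def IsPartition {n : ℕ} (l : Fin n → ℕ) : Prop := ∀ i j : Fin n, i ≤ j → l j ≤ l i

/-- The action `σ·μ := μ ∘ σ⁻¹`. -/
def permAct {n : ℕ} (σ : Equiv.Perm (Fin n)) (μ : Fin n → ℕ) : Fin n → ℕ := μ ∘ ⇑σ.symm

/-- `S_n(λ)`: the rearrangements of `λ`. -/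
def Sn {n : ℕ} (l : Fin n → ℕ) : Set (Fin n → ℕ) :=
  {μ | ∃ σ : Equiv.Perm (Fin n), permAct σ l = μ}

/-- The rearrangements of `λ` as a `Finset`. -/
def SnFinset {n : ℕ} (l : Fin n → ℕ) : Finset (Fin n → ℕ) :=
  Finset.image (fun σ : Equiv.Perm (Fin n) => permAct σ l) Finset.univ

/-- The exponent `Finsupp` of the monomial `x^μ`. -/
def expOf {n : ℕ} (μ : Fin n → ℕ) : Fin n →₀ ℕ := Finsupp.equivFunOnFinite.symm μ

/-- Characterization of the interpolation nonsymmetric Macdonald polynomial `E*_μ`. -/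
def IsEstar {n : ℕ} (μ : Fin n → ℕ) (f : MvPolynomial (Fin n) K) : Prop :=
  f.totalDegree ≤ csize μ ∧ coeff (expOf μ) f = 1 ∧
    ∀ ν : Fin n → ℕ, csize ν ≤ csize μ → ν ≠ μ → eval (evalPt ν) f = 0

/-- The interpolation nonsymmetric Macdonald polynomial `E*_μ` (unique by Knop–Sahi). -/
def Estar {n : ℕ} (μ : Fin n → ℕ) : MvPolynomial (Fin n) K :=
  if h : ∃ f, IsEstar μ f then h.choose else 0

/-- Characterization of the interpolation (symmetric) Macdonald polynomial `P*_λ`. -/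
def IsPstar {n : ℕ} (l : Fin n → ℕ) (f : MvPolynomial (Fin n) K) : Prop :=
  f.IsSymmetric ∧ f.totalDegree ≤ csize l ∧ coeff (expOf l) f = 1 ∧
    ∀ ν : Fin n → ℕ, IsPartition ν → csize ν ≤ csize l → ν ≠ l → eval (evalPt ν) f = 0

/-- The interpolation Macdonald polynomial `P*_λ`. -/
def Pstar {n : ℕ} (l : Fin n → ℕ) : MvPolynomial (Fin n) K :=
  if h : ∃ f, IsPstar l f then h.choose else 0

/-- The space `V*_λ`. -/
def Vstar {n : ℕ} (l : Fin n → ℕ) : Submodule K (MvPolynomial (Fin n) K) :=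
  (restrictTotalDegree (Fin n) K (csize l)) ⊓
    ⨅ (ν : Fin n → ℕ) (_ : csize ν ≤ csize l ∧ ν ∉ Sn l),
      LinearMap.ker (aeval (R := K) (evalPt ν)).toLinearMap

/-- Exchange of the variables `x_i` and `x_j` in a polynomial. -/
def swapVars {n : ℕ} (i j : Fin n) (f : MvPolynomial (Fin n) K) : MvPolynomial (Fin n) K :=
  rename (Equiv.swap i j) f

/-- Exact division of polynomials: the unique `g` with `a = b * g` when it exists. -/
def exactDiv {n : ℕ} (a b : MvPolynomial (Fin n) K) : MvPolynomial (Fin n) K :=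
  if h : ∃ g, a = b * g then h.choose else 0

/-- The Hecke operator
`T f = t f − ((t x_i − x_j)/(x_i − x_j))·(f − s_i f)` (where `j = i+1`). -/
def hecke {n : ℕ} (i j : Fin n) (f : MvPolynomial (Fin n) K) : MvPolynomial (Fin n) K :=
  C tt * f - (C tt * X i - X j) * exactDiv (f - swapVars i j f) (X i - X j)

/-- The Coxeter length of a permutation (number of inversions). -/
def permLength {n : ℕ} (σ : Equiv.Perm (Fin n)) : ℕ :=
  Set.ncard {p : Fin n × Fin n | p.1 < p.2 ∧ σ p.2 < σ p.1}

/-- The adjacent transposition `s_i = (i, i+1)` (0-indexed). -/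
def adjSwap {n : ℕ} (i : {i : ℕ // i + 1 < n}) : Equiv.Perm (Fin n) :=
  Equiv.swap ⟨i.1, Nat.lt_of_succ_lt i.2⟩ ⟨i.1 + 1, i.2⟩

/-- The Hecke operator `T_i` for an adjacent transposition index. -/
def heckeAt {n : ℕ} (i : {i : ℕ // i + 1 < n}) :
    MvPolynomial (Fin n) K → MvPolynomial (Fin n) K :=
  hecke ⟨i.1, Nat.lt_of_succ_lt i.2⟩ ⟨i.1 + 1, i.2⟩

/-- `T_{i_1} ⋯ T_{i_ℓ} f` for a word `w = [i_1, …, i_ℓ]`. -/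
def Tword {n : ℕ} (w : List {i : ℕ // i + 1 < n}) (f : MvPolynomial (Fin n) K) :
    MvPolynomial (Fin n) K :=
  w.foldr heckeAt f

/-- `w` is a reduced word for `σ`. -/
def IsReducedWordOf {n : ℕ} (w : List {i : ℕ // i + 1 < n}) (σ : Equiv.Perm (Fin n)) : Prop :=
  (w.map adjSwap).prod = σ ∧ w.length = permLength σ

/-- `T_σ`, computed from a reduced word of `σ` (independent of the choice, by the
Hecke algebra relations). -/
def Tsigma {n : ℕ} (σ : Equiv.Perm (Fin n)) :
    MvPolynomial (Fin n) K → MvPolynomial (Fin n) K :=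
  if h : ∃ w, IsReducedWordOf w σ then Tword h.choose else id

/-- `σ_μ`: the (unique) shortest permutation with `σ·l = μ`. -/
def sigmaMin {n : ℕ} (l μ : Fin n → ℕ) : Equiv.Perm (Fin n) :=
  if h : ∃ σ, permAct σ l = μ ∧ ∀ τ, permAct τ l = μ → permLength σ ≤ permLength τ then
    h.choose else 1

/-- The weakly decreasing rearrangement of a composition. -/
def sortDesc {n : ℕ} (μ : Fin n → ℕ) : Fin n → ℕ :=
  if h : ∃ l, IsPartition l ∧ μ ∈ Sn l then h.choose else μ

/-- The interpolation ASEP polynomial `f*_μ = T_{σ_μ} E*_λ`, where `λ` is the weakly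
decreasing rearrangement of `μ`. -/
def fstar {n : ℕ} (μ : Fin n → ℕ) : MvPolynomial (Fin n) K :=
  Tsigma (sigmaMin (sortDesc μ) μ) (Estar (sortDesc μ))

/-- The composition with entries `i` and `j` exchanged. -/
def swapEntries {n : ℕ} (i j : Fin n) (μ : Fin n → ℕ) : Fin n → ℕ := μ ∘ ⇑(Equiv.swap i j)
/-- `f̂*_μ := q^{|μ|} f*_μ(x/q)`. -/
def scaleQinv {n : ℕ} (f : MvPolynomial (Fin n) K) : MvPolynomial (Fin n) K :=
  aeval (fun j : Fin n => C qq⁻¹ * X j) f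

def fstarHat {n : ℕ} (μ : Fin n → ℕ) : MvPolynomial (Fin n) K :=
  C (qq ^ csize μ) * scaleQinv (fstar μ)

/-! ### Polynomial part -/

lemma swapVars_X {n : ℕ} (i j k : Fin n) : swapVars i j (X k) = X (Equiv.swap i j k) := by
  simp [swapVars]

lemma exists_div {n : ℕ} (i j : Fin n) (f : MvPolynomial (Fin n) K) :
    ∃ g, f - swapVars i j f = (X i - X j) * g := by
  induction f using MvPolynomial.induction_on with
  | C a => exact ⟨0, by simp [swapVars]⟩
  | add p q hp hq =>
    obtain ⟨g, hg⟩ := hp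
    obtain ⟨h, hh⟩ := hq
    refine ⟨g + h, ?_⟩
    have : swapVars i j (p + q) = swapVars i j p + swapVars i j q := by simp [swapVars]
    rw [this]
    linear_combination hg + hh
  | mul_X p k hp =>
    obtain ⟨g, hg⟩ := hp
    have h1 : swapVars i j (p * X k) = swapVars i j p * X (Equiv.swap i j k) := by
      simp [swapVars]
    have h2 : ∃ c : MvPolynomial (Fin n) K, X k - X (Equiv.swap i j k) = (X i - X j) * c := by
      by_cases hi : k = i
      · subst hi; exact ⟨1, by simp⟩
      by_cases hj : k = j
      · subst hj; exact ⟨-1, by rw [Equiv.swap_apply_right]; ring⟩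
      · exact ⟨0, by rw [Equiv.swap_apply_of_ne_of_ne hi hj]; simp⟩
    obtain ⟨c, hc⟩ := h2
    refine ⟨g * X k + swapVars i j p * c, ?_⟩
    rw [h1]
    linear_combination X k * hg + swapVars i j p * hc

lemma X_sub_X_ne {n : ℕ} {i j : Fin n} (h : i ≠ j) :
    (X i - X j : MvPolynomial (Fin n) K) ≠ 0 :=
  sub_ne_zero.mpr fun e => h (X_injective e)

lemma hecke_spec {n : ℕ} (i j : Fin n) (f : MvPolynomial (Fin n) K) :
    (X i - X j) * hecke i j f =
      C tt * (X i - X j) * f - (C tt * X i - X j) * (f - swapVars i j f) := by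
  have h := exists_div i j f
  have h2 : f - swapVars i j f = (X i - X j) * exactDiv (f - swapVars i j f) (X i - X j) := by
    unfold exactDiv
    rw [dif_pos h]
    exact h.choose_spec
  unfold hecke
  linear_combination (C tt * X i - X j) * h2

lemma hecke_unique {n : ℕ} {i j : Fin n} (hij : i ≠ j) {f g : MvPolynomial (Fin n) K}
    (h : (X i - X j) * g =
      C tt * (X i - X j) * f - (C tt * X i - X j) * (f - swapVars i j f)) :
    hecke i j f = g := by
  apply mul_left_cancel₀ (X_sub_X_ne hij)
  rw [h, hecke_spec]

/-- The fraction field of the polynomial ring. -/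
abbrev FF (n : ℕ) := FractionRing (MvPolynomial (Fin n) K)

/-- The embedding into the fraction field. -/
def ph (n : ℕ) : MvPolynomial (Fin n) K →+* FF n := algebraMap _ _

lemma ph_inj (n : ℕ) : Function.Injective (ph n) := IsFractionRing.injective _ _

lemma ph_ne {n : ℕ} {i j : Fin n} (h : i ≠ j) : ph n (X i) - ph n (X j) ≠ 0 := by
  rw [← map_sub]
  intro e
  exact X_sub_X_ne h (ph_inj n (by rw [e, map_zero]))

lemma ph_hecke {n : ℕ} {i j : Fin n} (h : i ≠ j) (f : MvPolynomial (Fin n) K) :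
    ph n (hecke i j f) = ph n (C tt) * ph n f -
      (ph n (C tt) * ph n (X i) - ph n (X j)) * (ph n f - ph n (swapVars i j f)) /
        (ph n (X i) - ph n (X j)) := by
  have h1 := congrArg (ph n) (hecke_spec i j f)
  simp only [map_sub, map_mul] at h1
  have h2 := ph_ne h
  field_simp
  linear_combination h1

/-- swap of variables commutes with the Hecke operators up to permuting indices. -/
lemma swapVars_hecke {n : ℕ} {i j : Fin n} (h : i ≠ j) (a b : Fin n)
    (f : MvPolynomial (Fin n) K) :
    swapVars a b (hecke i j f) =
      hecke (Equiv.swap a b i) (Equiv.swap a b j) (swapVars a b f) := by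
  symm
  apply hecke_unique (fun e => h ((Equiv.swap a b).injective e))
  have h1 := congrArg (swapVars a b) (hecke_spec i j f)
  have h2 : swapVars (Equiv.swap a b i) (Equiv.swap a b j) (swapVars a b f) =
      swapVars a b (swapVars i j f) := by
    unfold swapVars
    rw [rename_rename, rename_rename]
    congr 2
    funext x
    have := Equiv.swap_apply_apply (Equiv.swap a b) i j
    simp only [Function.comp_apply]
    rw [this]
    simp
  rw [h2]
  simpa [swapVars] using h1

lemma swapVars_swapVars {n : ℕ} (i j : Fin n) (f : MvPolynomial (Fin n) K) :
    swapVars i j (swapVars i j f) = f := by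
  unfold swapVars
  rw [rename_rename]
  have : (⇑(Equiv.swap i j) ∘ ⇑(Equiv.swap i j)) = id := by funext x; simp
  rw [this, rename_id]
  rfl

lemma swapVars_comm {n : ℕ} {i j a b : Fin n} (h1 : i ≠ a) (h2 : i ≠ b) (h3 : j ≠ a)
    (h4 : j ≠ b) (f : MvPolynomial (Fin n) K) :
    swapVars i j (swapVars a b f) = swapVars a b (swapVars i j f) := by
  unfold swapVars
  rw [rename_rename, rename_rename]
  congr 2
  funext x
  simp only [Function.comp_apply, Equiv.swap_apply_def]
  grind

lemma swapVars_braid {n : ℕ} {i j k : Fin n} (h1 : i ≠ j) (h2 : j ≠ k) (h3 : i ≠ k)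
    (f : MvPolynomial (Fin n) K) :
    swapVars i j (swapVars j k (swapVars i j f)) =
      swapVars j k (swapVars i j (swapVars j k f)) := by
  unfold swapVars
  simp only [rename_rename]
  congr 2
  funext x
  simp only [Function.comp_apply, Equiv.swap_apply_def]
  grind

lemma hecke_quad {n : ℕ} {i j : Fin n} (h : i ≠ j) (f : MvPolynomial (Fin n) K) :
    hecke i j (hecke i j f) = (C tt - 1) * hecke i j f + C tt * f := by
  apply ph_inj
  have h2 := ph_ne h
  have h3 := ph_ne h.symm
  rw [ph_hecke h, swapVars_hecke h, Equiv.swap_apply_left, Equiv.swap_apply_right]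
  simp only [map_add, map_mul, map_sub, map_one]
  rw [ph_hecke h, ph_hecke h.symm]
  rw [show swapVars j i (swapVars i j f) = f by
    rw [show swapVars j i (swapVars i j f) = swapVars i j (swapVars i j f) by
      unfold swapVars; rw [Equiv.swap_comm], swapVars_swapVars]]
  generalize ph n (X i) = x at *
  generalize ph n (X j) = y at *
  generalize ph n (C tt) = t
  generalize ph n f = u
  generalize ph n (swapVars i j f) = v
  have h4 : y - x = -(x - y) := by ring
  rw [h4]
  field_simp
  ring

lemma hecke_comm {n : ℕ} {i j a b : Fin n} (hij : i ≠ j) (hab : a ≠ b)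
    (h1 : i ≠ a) (h2 : i ≠ b) (h3 : j ≠ a) (h4 : j ≠ b) (f : MvPolynomial (Fin n) K) :
    hecke i j (hecke a b f) = hecke a b (hecke i j f) := by
  apply ph_inj
  have d1 := ph_ne hij
  have d2 := ph_ne hab
  rw [ph_hecke hij, swapVars_hecke hab, Equiv.swap_apply_of_ne_of_ne h1.symm h3.symm,
    Equiv.swap_apply_of_ne_of_ne h2.symm h4.symm, ph_hecke hab, ph_hecke hab,
    ph_hecke hab, swapVars_hecke hij, Equiv.swap_apply_of_ne_of_ne h1 h2,
    Equiv.swap_apply_of_ne_of_ne h3 h4, ph_hecke hij, ph_hecke hij,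
    swapVars_comm h1 h2 h3 h4]
  field_simp
  ring

lemma hecke_braid {n : ℕ} {i j k : Fin n} (h1 : i ≠ j) (h2 : j ≠ k) (h3 : i ≠ k)
    (f : MvPolynomial (Fin n) K) :
    hecke i j (hecke j k (hecke i j f)) = hecke j k (hecke i j (hecke j k f)) := by
  apply ph_inj
  have d1 := ph_ne h1
  have d2 := ph_ne h2
  have d3 := ph_ne h3
  have sw : ∀ (a b : Fin n) (g : MvPolynomial (Fin n) K), swapVars b a g = swapVars a b g := by
    intro a b g; unfold swapVars; rw [Equiv.swap_comm]
  have e1 : Equiv.swap i j k = k := Equiv.swap_apply_of_ne_of_ne h3.symm h2.symm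
  have e2 : Equiv.swap j k i = i := Equiv.swap_apply_of_ne_of_ne h1 h3
  have e3 : Equiv.swap i k j = j := Equiv.swap_apply_of_ne_of_ne h1.symm h2
  have e4 : Equiv.swap k i j = j := Equiv.swap_apply_of_ne_of_ne h2 h1.symm
  have c1 : ∀ g : MvPolynomial (Fin n) K,
      swapVars i k g = swapVars i j (swapVars j k (swapVars i j g)) := by
    intro g
    unfold swapVars
    simp only [rename_rename]
    congr 2
    funext x
    simp only [Function.comp_apply, Equiv.swap_apply_def]
    grind
  have d1' : ph n (X j) - ph n (X i) ≠ 0 := ph_ne h1.symm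
  have d2' : ph n (X k) - ph n (X j) ≠ 0 := ph_ne h2.symm
  have d3' : ph n (X k) - ph n (X i) ≠ 0 := ph_ne h3.symm
  simp only [ph_hecke h1, ph_hecke h2, ph_hecke h3, ph_hecke h1.symm, ph_hecke h2.symm,
    ph_hecke h3.symm, swapVars_hecke h3.symm,
    swapVars_hecke h1, swapVars_hecke h2, swapVars_hecke h3, Equiv.swap_apply_left,
    Equiv.swap_apply_right, e1, e2, e3, e4, sw i j, sw j k,
    swapVars_hecke h1.symm, swapVars_hecke h2.symm]
  simp only [sw i k, c1, swapVars_swapVars]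
  simp only [← swapVars_braid h1 h2 h3, swapVars_swapVars]
  generalize ph n (X i) = x at *
  generalize ph n (X j) = y at *
  generalize ph n (X k) = z at *
  generalize ph n (C tt) = t
  generalize ph n f = u0
  generalize ph n (swapVars i j f) = u1
  generalize ph n (swapVars j k f) = u2
  generalize ph n (swapVars i j (swapVars j k f)) = u12
  generalize ph n (swapVars j k (swapVars i j f)) = u21
  generalize ph n (swapVars i j (swapVars j k (swapVars i j f))) = u121
  have n1 : y - x = -(x - y) := by ring
  have n2 : z - y = -(y - z) := by ring
  try rw [n1]
  try rw [n2]
  try rw [show z - x = -(x - z) by ring]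
  field_simp
  ring

/-! ### Permutations and reduced words -/

/-- Lower index of an adjacent transposition. -/
def lo {n : ℕ} (i : {i : ℕ // i + 1 < n}) : Fin n := ⟨i.1, Nat.lt_of_succ_lt i.2⟩

/-- Upper index of an adjacent transposition. -/
def hi {n : ℕ} (i : {i : ℕ // i + 1 < n}) : Fin n := ⟨i.1 + 1, i.2⟩

lemma adjSwap_eq {n : ℕ} (i : {i : ℕ // i + 1 < n}) :
    adjSwap i = Equiv.swap (lo i) (hi i) := rfl

lemma heckeAt_eq {n : ℕ} (i : {i : ℕ // i + 1 < n}) :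
    heckeAt i = hecke (lo i) (hi i) := rfl

lemma lo_ne_hi {n : ℕ} (i : {i : ℕ // i + 1 < n}) : lo i ≠ hi i := by
  intro h
  have := congrArg Fin.val h
  simp [lo, hi] at this

lemma adjSwap_mul_self {n : ℕ} (i : {i : ℕ // i + 1 < n}) :
    adjSwap i * adjSwap i = 1 := by
  rw [adjSwap_eq, Equiv.swap_mul_self]

lemma adjSwap_mul_cancel {n : ℕ} (i : {i : ℕ // i + 1 < n}) (σ : Equiv.Perm (Fin n)) :
    adjSwap i * (adjSwap i * σ) = σ := by
  rw [← mul_assoc, adjSwap_mul_self, one_mul]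

lemma adjSwap_lt_iff {n : ℕ} (i : {i : ℕ // i + 1 < n}) (a b : Fin n)
    (h1 : ¬ (a = lo i ∧ b = hi i)) (h2 : ¬ (a = hi i ∧ b = lo i)) :
    adjSwap i a < adjSwap i b ↔ a < b := by
  rw [adjSwap_eq]
  simp only [Equiv.swap_apply_def, lo, hi, Fin.ext_iff, Fin.lt_def] at *
  split_ifs <;> simp only at * <;> omega

lemma length_up {n : ℕ} (i : {i : ℕ // i + 1 < n}) (σ : Equiv.Perm (Fin n))
    (h : σ.symm (lo i) < σ.symm (hi i)) :
    permLength (adjSwap i * σ) = permLength σ + 1 := by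
  unfold permLength
  have hset : {p : Fin n × Fin n | p.1 < p.2 ∧ (adjSwap i * σ) p.2 < (adjSwap i * σ) p.1} =
      insert (σ.symm (lo i), σ.symm (hi i))
        {p : Fin n × Fin n | p.1 < p.2 ∧ σ p.2 < σ p.1} := by
    ext ⟨a, b⟩
    simp only [Set.mem_ofPred_eq, Set.mem_insert_iff, Prod.mk.injEq, Equiv.Perm.mul_apply]
    by_cases c1 : σ a = lo i ∧ σ b = hi i
    · have ea : a = σ.symm (lo i) := by rw [← c1.1]; simp
      have eb : b = σ.symm (hi i) := by rw [← c1.2]; simp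
      rw [c1.1, c1.2, ea, eb]
      simp only [h, true_and, and_self, true_or, iff_true]
      rw [adjSwap_eq, Equiv.swap_apply_left, Equiv.swap_apply_right]
      simp [lo, hi, Fin.lt_def]
    · have c1' : ¬ (a = σ.symm (lo i) ∧ b = σ.symm (hi i)) := by
        rintro ⟨rfl, rfl⟩; exact c1 (by simp)
      simp only [c1', false_or]
      by_cases c2 : σ a = hi i ∧ σ b = lo i
      · have ea : a = σ.symm (hi i) := by rw [← c2.1]; simp
        have eb : b = σ.symm (lo i) := by rw [← c2.2]; simp
        have : ¬ a < b := by rw [ea, eb]; exact not_lt.mpr h.le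
        simp [this]
      · rw [adjSwap_lt_iff i (σ b) (σ a) (fun e => c2 ⟨e.2, e.1⟩) (fun e => c1 ⟨e.2, e.1⟩)]
  rw [hset, Set.ncard_insert_of_notMem _ (Set.toFinite _)]
  simp only [Set.mem_ofPred_eq, Equiv.apply_symm_apply, not_and, not_lt]
  intro _
  simp [lo, hi, Fin.le_def]

lemma length_down {n : ℕ} (i : {i : ℕ // i + 1 < n}) (σ : Equiv.Perm (Fin n))
    (h : σ.symm (hi i) < σ.symm (lo i)) :
    permLength σ = permLength (adjSwap i * σ) + 1 := by
  have := length_up i (adjSwap i * σ) (by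
    have e : ∀ x, (adjSwap i * σ).symm x = σ.symm (adjSwap i x) := by
      intro x
      rw [Equiv.symm_apply_eq, Equiv.Perm.mul_apply, Equiv.apply_symm_apply,
        ← Equiv.Perm.mul_apply, adjSwap_mul_self]
      rfl
    rw [e, e, adjSwap_eq, Equiv.swap_apply_left, Equiv.swap_apply_right]
    exact h)
  rwa [adjSwap_mul_cancel] at this

lemma symm_ne {n : ℕ} (i : {i : ℕ // i + 1 < n}) (σ : Equiv.Perm (Fin n)) :
    σ.symm (lo i) ≠ σ.symm (hi i) := fun e => lo_ne_hi i (σ.symm.injective e)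

lemma length_le {n : ℕ} (i : {i : ℕ // i + 1 < n}) (σ : Equiv.Perm (Fin n)) :
    permLength (adjSwap i * σ) ≤ permLength σ + 1 := by
  rcases lt_or_gt_of_ne (symm_ne i σ) with h | h
  · exact (length_up i σ h).le
  · have := length_down i σ h; omega

lemma permLength_one {n : ℕ} : permLength (1 : Equiv.Perm (Fin n)) = 0 := by
  unfold permLength
  rw [Set.ncard_eq_zero]
  ext ⟨a, b⟩
  simp only [Equiv.Perm.one_apply, Set.mem_ofPred_eq, Set.mem_empty_iff_false, iff_false]
  rintro ⟨h1, h2⟩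
  exact absurd h1 h2.asymm

lemma length_word {n : ℕ} (w : List {i : ℕ // i + 1 < n}) :
    permLength (w.map adjSwap).prod ≤ w.length := by
  induction w with
  | nil => simp [permLength_one]
  | cons i w ih =>
    simp only [List.map_cons, List.prod_cons, List.length_cons]
    exact (length_le i _).trans (by omega)

lemma perm_strictMono_eq {n : ℕ} (σ : Equiv.Perm (Fin n)) (h : StrictMono σ) : σ = 1 := by
  have := Subsingleton.elim (h.orderIsoOfSurjective σ σ.surjective) (OrderIso.refl (Fin n))
  ext x
  have h2 := congrArg (fun e : Fin n ≃o Fin n => (e x : ℕ)) this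
  simpa using h2

lemma strictMono_of_adj {n : ℕ} (f : Fin n → Fin n)
    (h : ∀ i : {i : ℕ // i + 1 < n}, f (lo i) < f (hi i)) : StrictMono f := by
  cases n with
  | zero => intro a; exact a.elim0
  | succ m =>
    rw [Fin.strictMono_iff_lt_succ]
    intro i
    exact h ⟨i.1, by omega⟩

lemma exists_reduced {n : ℕ} (σ : Equiv.Perm (Fin n)) : ∃ w, IsReducedWordOf w σ := by
  induction hm : permLength σ generalizing σ with
  | zero =>
    refine ⟨[], ?_, by simp [hm]⟩
    have : StrictMono σ.symm := by
      apply strictMono_of_adj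
      intro i
      rcases lt_or_gt_of_ne (symm_ne i σ) with h | h
      · exact h
      · have := length_down i σ h; omega
    have := perm_strictMono_eq σ.symm this
    simp only [List.map_nil, List.prod_nil]
    have h2 : σ = (1 : Equiv.Perm (Fin n)).symm := by rw [← this, Equiv.symm_symm]
    rw [h2]; rfl
  | succ m ih =>
    by_cases hex : ∃ i : {i : ℕ // i + 1 < n}, σ.symm (hi i) < σ.symm (lo i)
    · obtain ⟨i, h⟩ := hex
      have hl := length_down i σ h
      obtain ⟨w, h1, h2⟩ := ih (adjSwap i * σ) (by omega)
      refine ⟨i :: w, ?_, ?_⟩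
      · rw [List.map_cons, List.prod_cons, h1, adjSwap_mul_cancel]
      · rw [List.length_cons]; omega
    · push Not at hex
      have : StrictMono σ.symm := by
        apply strictMono_of_adj
        intro i
        exact lt_of_le_of_ne (hex i) (symm_ne i σ)
      have := perm_strictMono_eq σ.symm this
      have h2 : σ = (1 : Equiv.Perm (Fin n)).symm := by rw [← this, Equiv.symm_symm]
      have h3 : σ = 1 := by rw [h2]; rfl
      rw [h3, permLength_one] at hm
      omega

lemma reduced_cons {n : ℕ} {i : {i : ℕ // i + 1 < n}} {w : List {i : ℕ // i + 1 < n}}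
    {σ : Equiv.Perm (Fin n)} (h : IsReducedWordOf (i :: w) σ) :
    IsReducedWordOf w (adjSwap i * σ) ∧ σ.symm (hi i) < σ.symm (lo i) := by
  obtain ⟨h1, h2⟩ := h
  rw [List.map_cons, List.prod_cons] at h1
  rw [List.length_cons] at h2
  have hw : (w.map adjSwap).prod = adjSwap i * σ := by
    rw [← h1, adjSwap_mul_cancel]
  have hl := length_word w
  rw [hw] at hl
  rcases lt_or_gt_of_ne (symm_ne i σ) with h | h
  · have := length_up i σ h; omega
  · have := length_down i σ h
    exact ⟨⟨hw, by omega⟩, h⟩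

lemma reduced_cons' {n : ℕ} {i : {i : ℕ // i + 1 < n}} {w : List {i : ℕ // i + 1 < n}}
    {σ : Equiv.Perm (Fin n)} (h : IsReducedWordOf w (adjSwap i * σ))
    (hd : σ.symm (hi i) < σ.symm (lo i)) : IsReducedWordOf (i :: w) σ := by
  refine ⟨?_, ?_⟩
  · rw [List.map_cons, List.prod_cons, h.1, adjSwap_mul_cancel]
  · rw [List.length_cons, h.2, length_down i σ hd]

lemma adj_symm {n : ℕ} (i : {i : ℕ // i + 1 < n}) (σ : Equiv.Perm (Fin n)) (x : Fin n) :
    (adjSwap i * σ).symm x = σ.symm (adjSwap i x) := by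
  rw [Equiv.symm_apply_eq, Equiv.Perm.mul_apply, Equiv.apply_symm_apply,
    ← Equiv.Perm.mul_apply, adjSwap_mul_self]
  rfl

lemma Tword_cons {n : ℕ} (i : {i : ℕ // i + 1 < n}) (w : List {i : ℕ // i + 1 < n})
    (f : MvPolynomial (Fin n) K) : Tword (i :: w) f = heckeAt i (Tword w f) := rfl

lemma heckeAt_comm {n : ℕ} {i j : {i : ℕ // i + 1 < n}} (h : i.1 + 2 ≤ j.1)
    (f : MvPolynomial (Fin n) K) : heckeAt i (heckeAt j f) = heckeAt j (heckeAt i f) := by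
  rw [heckeAt_eq, heckeAt_eq]
  apply hecke_comm (lo_ne_hi i) (lo_ne_hi j) <;>
  · intro e
    have := congrArg Fin.val e
    simp only [lo, hi] at this
    omega

lemma heckeAt_braid {n : ℕ} {i j : {i : ℕ // i + 1 < n}} (h : j.1 = i.1 + 1)
    (f : MvPolynomial (Fin n) K) :
    heckeAt i (heckeAt j (heckeAt i f)) = heckeAt j (heckeAt i (heckeAt j f)) := by
  rw [heckeAt_eq, heckeAt_eq]
  have e : hi i = lo j := by simp [hi, lo, h]
  rw [← e]
  apply hecke_braid
  · exact lo_ne_hi i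
  · rw [e]; exact lo_ne_hi j
  · intro e
    have := congrArg Fin.val e
    simp only [lo, hi] at this
    omega

lemma adjSwap_ne {n : ℕ} {i : {i : ℕ // i + 1 < n}} {x : Fin n} (h1 : x.1 ≠ i.1)
    (h2 : x.1 ≠ i.1 + 1) : adjSwap i x = x := by
  rw [adjSwap_eq]
  apply Equiv.swap_apply_of_ne_of_ne
  · exact fun e => h1 (congrArg Fin.val e)
  · exact fun e => h2 (congrArg Fin.val e)

lemma adjSwap_lo {n : ℕ} (i : {i : ℕ // i + 1 < n}) : adjSwap i (lo i) = hi i :=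
  Equiv.swap_apply_left _ _

lemma adjSwap_hi {n : ℕ} (i : {i : ℕ // i + 1 < n}) : adjSwap i (hi i) = lo i :=
  Equiv.swap_apply_right _ _

lemma adjSwap_comm {n : ℕ} {i j : {i : ℕ // i + 1 < n}} (h : i.1 + 2 ≤ j.1) :
    adjSwap i * adjSwap j = adjSwap j * adjSwap i := by
  ext x
  simp only [adjSwap, Equiv.Perm.mul_apply, Equiv.swap_apply_def, Fin.ext_iff]
  split_ifs <;> simp only at * <;> omega

lemma adjSwap_braid {n : ℕ} {i j : {i : ℕ // i + 1 < n}} (h : j.1 = i.1 + 1) :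
    adjSwap i * (adjSwap j * adjSwap i) = adjSwap j * (adjSwap i * adjSwap j) := by
  have e1 : lo i ≠ hi i := lo_ne_hi i
  have e : lo j = hi i := by simp [hi, lo, h]
  have e2 : hi i ≠ hi j := by rw [← e]; exact lo_ne_hi j
  have e3 : lo i ≠ hi j := by simp [hi, lo, h]; omega
  rw [adjSwap_eq, adjSwap_eq, e]
  generalize lo i = a at *
  generalize hi i = b at *
  generalize hi j = c at *
  ext x
  simp only [Equiv.Perm.mul_apply, Equiv.swap_apply_def]
  grind

/-- The key step of Matsumoto's theorem. -/
lemma matsumoto_step {n : ℕ} (m : ℕ)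
    (ih : ∀ (σ : Equiv.Perm (Fin n)), permLength σ < m → ∀ w w', IsReducedWordOf w σ →
      IsReducedWordOf w' σ → ∀ f, Tword w f = Tword w' f)
    (σ : Equiv.Perm (Fin n)) (hm : permLength σ = m)
    {i j : {i : ℕ // i + 1 < n}} (hlt : i.1 < j.1) (u u' : List {i : ℕ // i + 1 < n})
    (hu : IsReducedWordOf (i :: u) σ) (hu' : IsReducedWordOf (j :: u') σ)
    (f : MvPolynomial (Fin n) K) : Tword (i :: u) f = Tword (j :: u') f := by
  obtain ⟨hu1, hd⟩ := reduced_cons hu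
  obtain ⟨hu2, hd'⟩ := reduced_cons hu'
  have hl1 := length_down i σ hd
  have hl2 := length_down j σ hd'
  rw [Tword_cons, Tword_cons]
  by_cases hfar : i.1 + 2 ≤ j.1
  · obtain ⟨v, hv⟩ := exists_reduced (adjSwap j * (adjSwap i * σ))
    have a1 : IsReducedWordOf (j :: v) (adjSwap i * σ) := by
      apply reduced_cons' hv
      rw [adj_symm, adj_symm, adjSwap_ne, adjSwap_ne]
      · exact hd'
      all_goals simp [lo, hi]; omega
    have a2 : IsReducedWordOf (i :: v) (adjSwap j * σ) := by
      apply reduced_cons'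
      · rw [← mul_assoc, adjSwap_comm hfar, mul_assoc]; exact hv
      rw [adj_symm, adj_symm, adjSwap_ne, adjSwap_ne]
      · exact hd
      all_goals simp [lo, hi]; omega
    rw [ih _ (by omega) _ _ hu1 a1, ih _ (by omega) _ _ hu2 a2, Tword_cons, Tword_cons,
      heckeAt_comm hfar]
  · have hj : j.1 = i.1 + 1 := by omega
    have e : lo j = hi i := by simp [hi, lo, hj]
    have s1 : adjSwap i (hi j) = hi j := by apply adjSwap_ne <;> simp [hi] <;> omega
    have s2 : adjSwap j (lo i) = lo i := by apply adjSwap_ne <;> simp [lo] <;> omega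
    obtain ⟨v, hv⟩ := exists_reduced (adjSwap i * (adjSwap j * (adjSwap i * σ)))
    have hv' : IsReducedWordOf v (adjSwap j * (adjSwap i * (adjSwap j * σ))) := by
      have := adjSwap_braid hj
      have e2 : adjSwap j * (adjSwap i * (adjSwap j * σ)) =
          adjSwap i * (adjSwap j * (adjSwap i * σ)) := by
        rw [← mul_assoc (adjSwap i), ← mul_assoc (adjSwap j), ← this]
        simp only [mul_assoc]
      rw [e2]; exact hv
    rw [e] at hd'
    have a1 : IsReducedWordOf (j :: i :: v) (adjSwap i * σ) := by
      apply reduced_cons'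
      · apply reduced_cons' hv
        rw [adj_symm, adj_symm, adj_symm, adj_symm, s2, adjSwap_lo, ← e, adjSwap_lo, s1, e]
        exact hd'
      · rw [adj_symm, adj_symm, s1, e, adjSwap_hi]
        exact hd'.trans hd
    have a2 : IsReducedWordOf (i :: j :: v) (adjSwap j * σ) := by
      apply reduced_cons'
      · apply reduced_cons' hv'
        rw [adj_symm, adj_symm, adj_symm, adj_symm, s1, adjSwap_hi, e, adjSwap_hi, s2, ← e]
        rw [e]; exact hd
      · rw [adj_symm, adj_symm, s2, ← e, adjSwap_lo]
        exact hd'.trans hd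
    rw [ih _ (by omega) _ _ hu1 a1, ih _ (by omega) _ _ hu2 a2]
    simp only [Tword_cons]
    exact heckeAt_braid hj _

lemma matsumoto {n : ℕ} (σ : Equiv.Perm (Fin n)) (w w' : List {i : ℕ // i + 1 < n})
    (h : IsReducedWordOf w σ) (h' : IsReducedWordOf w' σ) (f : MvPolynomial (Fin n) K) :
    Tword w f = Tword w' f := by
  induction hm : permLength σ using Nat.strong_induction_on generalizing σ w w' f with
  | _ m ih =>
  have ih' : ∀ (σ : Equiv.Perm (Fin n)), permLength σ < m → ∀ w w', IsReducedWordOf w σ →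
      IsReducedWordOf w' σ → ∀ f, Tword w f = Tword w' f :=
    fun σ hσ w w' h h' f => ih _ hσ σ w w' h h' f rfl
  have hlen : w.length = w'.length := h.2.trans h'.2.symm
  cases w with
  | nil =>
    cases w' with
    | nil => rfl
    | cons => simp at hlen
  | cons i u =>
    cases w' with
    | nil => simp at hlen
    | cons j u' =>
      rcases lt_trichotomy i.1 j.1 with hij | hij | hij
      · exact matsumoto_step m ih' σ hm hij u u' h h' f
      · have : i = j := Subtype.ext hij
        subst this
        have h1 := reduced_cons h
        have h2 := reduced_cons h'
        rw [Tword_cons, Tword_cons]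
        rw [ih' _ _ _ _ h1.1 h2.1]
        have := length_down i σ h1.2
        omega
      · exact (matsumoto_step m ih' σ hm hij u' u h' h f).symm

lemma Tsigma_eq {n : ℕ} {σ : Equiv.Perm (Fin n)} {w : List {i : ℕ // i + 1 < n}}
    (h : IsReducedWordOf w σ) (f : MvPolynomial (Fin n) K) : Tsigma σ f = Tword w f := by
  have hex : ∃ w, IsReducedWordOf w σ := ⟨w, h⟩
  unfold Tsigma
  rw [dif_pos hex]
  exact matsumoto σ _ _ hex.choose_spec h f

lemma permLength_symm {n : ℕ} (σ : Equiv.Perm (Fin n)) : permLength σ.symm = permLength σ := by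
  unfold permLength
  refine Set.ncard_congr (fun p _ => (σ.symm p.2, σ.symm p.1)) ?_ ?_ ?_
  · rintro ⟨a, b⟩ ⟨h1, h2⟩
    exact ⟨h2, by simpa using h1⟩
  · rintro ⟨a, b⟩ ⟨c, d⟩ _ _ h
    simp only [Prod.mk.injEq, EmbeddingLike.apply_eq_iff_eq] at h
    exact Prod.ext h.2 h.1
  · rintro ⟨a, b⟩ ⟨h1, h2⟩
    exact ⟨(σ b, σ a), ⟨h2, by simpa using h1⟩, by simp⟩

/-- `σ` is increasing on the level sets of `l`. -/
def Good {n : ℕ} (l : Fin n → ℕ) (σ : Equiv.Perm (Fin n)) : Prop :=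
  ∀ a b, a < b → l a = l b → σ a < σ b

lemma good_of_min {n : ℕ} {l : Fin n → ℕ} (hl : IsPartition l) {μ : Fin n → ℕ}
    {σ : Equiv.Perm (Fin n)} (h : permAct σ l = μ)
    (hmin : ∀ τ, permAct τ l = μ → permLength σ ≤ permLength τ) : Good l σ := by
  have key : ∀ k : {i : ℕ // i + 1 < n}, l (lo k) = l (hi k) → σ (lo k) < σ (hi k) := by
    intro k hk
    by_contra hc
    have hc' : σ (hi k) < σ (lo k) :=
      lt_of_le_of_ne (not_lt.mp hc) (fun e => lo_ne_hi k (σ.injective e).symm)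
    have hd := length_down k σ.symm (by simpa using hc')
    have hm := hmin (adjSwap k * σ.symm).symm (by
      rw [← h]
      funext x
      simp only [permAct, Function.comp_apply, Equiv.symm_symm, Equiv.Perm.mul_apply]
      generalize σ.symm x = y
      by_cases h1 : y = lo k
      · rw [h1, adjSwap_lo, hk]
      by_cases h2 : y = hi k
      · rw [h2, adjSwap_hi, hk]
      rw [adjSwap_eq, Equiv.swap_apply_of_ne_of_ne h1 h2])
    rw [permLength_symm] at hm hd
    omega
  have step : ∀ (d : ℕ) (a b : Fin n), b.1 = a.1 + d + 1 → l a = l b → σ a < σ b := by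
    intro d
    induction d with
    | zero =>
      intro a b hab hl'
      have ha : lo ⟨a.1, by omega⟩ = a := rfl
      have hb : hi ⟨a.1, by omega⟩ = b := by simp [hi, Fin.ext_iff, hab]
      have := key ⟨a.1, by omega⟩
      rw [ha, hb] at this
      exact this hl'
    | succ d ih =>
      intro a b hab hl'
      let c : Fin n := ⟨a.1 + d + 1, by omega⟩
      have h1 : l c ≤ l a := hl a c (by simp [Fin.le_def, c]; omega)
      have h2 : l b ≤ l c := hl c b (by simp [Fin.le_def, c]; omega)
      have hac := ih a c rfl (by omega)
      have ha : lo ⟨c.1, by simp only [c]; omega⟩ = c := rfl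
      have hb : hi ⟨c.1, by simp only [c]; omega⟩ = b := by
        simp only [hi, Fin.ext_iff, hab, c]; omega
      have := key ⟨c.1, by simp only [c]; omega⟩
      rw [ha, hb] at this
      exact hac.trans (this (by omega))
  intro a b hab hl'
  exact step (b.1 - a.1 - 1) a b (by have := Fin.lt_def.mp hab; omega) hl'

lemma good_lt {n : ℕ} {l : Fin n → ℕ} (hl : IsPartition l) {μ : Fin n → ℕ}
    {σ : Equiv.Perm (Fin n)} (h : permAct σ l = μ) (hg : Good l σ) (x y : Fin n) :
    σ.symm x < σ.symm y ↔ (μ y < μ x ∨ (μ x = μ y ∧ x < y)) := by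
  have hx : μ x = l (σ.symm x) := by rw [← h]; rfl
  have hy : μ y = l (σ.symm y) := by rw [← h]; rfl
  have e1 : σ (σ.symm x) = x := by simp
  have e2 : σ (σ.symm y) = y := by simp
  rw [hx, hy]
  constructor
  · intro hlt
    rcases (hl _ _ hlt.le).lt_or_eq with h1 | h1
    · exact Or.inl h1
    · have := hg _ _ hlt h1.symm
      rw [e1, e2] at this
      exact Or.inr ⟨h1.symm, this⟩
  · rintro (h1 | ⟨h1, h2⟩)
    · by_contra hc
      have := hl _ _ (not_lt.mp hc)
      omega
    · rcases lt_trichotomy (σ.symm x) (σ.symm y) with h3 | h3 | h3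
      · exact h3
      · exact absurd (σ.symm.injective h3) h2.ne
      · have := hg _ _ h3 h1.symm
        rw [e1, e2] at this
        exact absurd this h2.asymm

lemma good_unique {n : ℕ} {l : Fin n → ℕ} (hl : IsPartition l) {μ : Fin n → ℕ}
    {σ τ : Equiv.Perm (Fin n)} (h : permAct σ l = μ) (hg : Good l σ)
    (h' : permAct τ l = μ) (hg' : Good l τ) : σ = τ := by
  have hs : StrictMono (σ.symm * τ) := by
    intro a b hab
    have k1 := good_lt hl h hg (τ a) (τ b)
    have k2 := good_lt hl h' hg' (τ a) (τ b)
    rw [Equiv.symm_apply_apply, Equiv.symm_apply_apply] at k2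
    rw [Equiv.Perm.mul_apply, Equiv.Perm.mul_apply]
    exact k1.mpr (k2.mp hab)
  have h1 := perm_strictMono_eq _ hs
  ext x
  have h2 := congrArg (fun e : Equiv.Perm (Fin n) => σ (e x)) h1
  simp only [Equiv.Perm.mul_apply, Equiv.apply_symm_apply, Equiv.Perm.one_apply] at h2
  rw [h2]

lemma sigmaMin_spec {n : ℕ} {l μ : Fin n → ℕ} (hl : IsPartition l) (hμ : μ ∈ Sn l) :
    permAct (sigmaMin l μ) l = μ ∧ Good l (sigmaMin l μ) := by
  have hex : ∃ σ, permAct σ l = μ ∧ ∀ τ, permAct τ l = μ → permLength σ ≤ permLength τ := by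
    obtain ⟨σ, h1, h2⟩ := Set.exists_min_image {τ : Equiv.Perm (Fin n) | permAct τ l = μ}
      permLength (Set.toFinite _) hμ
    exact ⟨σ, h1, h2⟩
  unfold sigmaMin
  rw [dif_pos hex]
  exact ⟨hex.choose_spec.1, good_of_min hl hex.choose_spec.1 hex.choose_spec.2⟩

lemma sortDesc_spec {n : ℕ} (μ : Fin n → ℕ) :
    IsPartition (sortDesc μ) ∧ μ ∈ Sn (sortDesc μ) := by
  have hex : ∃ l, IsPartition l ∧ μ ∈ Sn l := by
    let g : Fin n → ℕᵒᵈ := fun x => OrderDual.toDual (μ x)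
    have hm := Tuple.monotone_sort g
    refine ⟨μ ∘ Tuple.sort g, fun i j hij => hm hij, Tuple.sort g, ?_⟩
    funext x
    simp [permAct]
  unfold sortDesc
  rw [dif_pos hex]
  exact hex.choose_spec

lemma swapEntries_swapEntries {n : ℕ} (i j : Fin n) (μ : Fin n → ℕ) :
    swapEntries i j (swapEntries i j μ) = μ := by
  funext x; simp [swapEntries]

lemma swapEntries_mem {n : ℕ} (i j : Fin n) {μ l : Fin n → ℕ} (h : μ ∈ Sn l) :
    swapEntries i j μ ∈ Sn l := by
  obtain ⟨σ, rfl⟩ := h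
  refine ⟨Equiv.swap i j * σ, ?_⟩
  funext x
  simp only [permAct, swapEntries, Function.comp_apply]
  congr 1

lemma sortDesc_swap {n : ℕ} (i j : Fin n) (μ : Fin n → ℕ) :
    sortDesc (swapEntries i j μ) = sortDesc μ := by
  have e : (fun l => IsPartition l ∧ swapEntries i j μ ∈ Sn l) =
      (fun l => IsPartition l ∧ μ ∈ Sn l) := by
    funext l
    apply propext
    refine and_congr_right fun _ => ⟨fun h => ?_, swapEntries_mem i j⟩
    have := swapEntries_mem i j h
    rwa [swapEntries_swapEntries] at this
  have h1 : ∃ l, IsPartition l ∧ μ ∈ Sn l := ⟨_, sortDesc_spec μ⟩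
  have h2 : ∃ l, IsPartition l ∧ swapEntries i j μ ∈ Sn l := ⟨_, sortDesc_spec _⟩
  unfold sortDesc
  rw [dif_pos h1, dif_pos h2]
  congr 1

lemma sigmaMin_swap {n : ℕ} {l μ : Fin n → ℕ} (hl : IsPartition l) (hμ : μ ∈ Sn l)
    (k : {i : ℕ // i + 1 < n}) (h : μ (hi k) < μ (lo k)) :
    sigmaMin l (swapEntries (lo k) (hi k) μ) = adjSwap k * sigmaMin l μ := by
  obtain ⟨h1, h2⟩ := sigmaMin_spec hl hμ
  obtain ⟨h3, h4⟩ := sigmaMin_spec hl (swapEntries_mem (lo k) (hi k) hμ)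
  refine good_unique hl h3 h4 ?_ ?_
  · funext x
    rw [permAct, Function.comp_apply, adj_symm]
    exact congrFun h1 _
  · intro a b hab hlab
    have := h2 a b hab hlab
    have v : ∀ z, μ (sigmaMin l μ z) = l z := by
      intro z
      conv_lhs => rw [← congrFun h1]
      simp [permAct]
    rw [Equiv.Perm.mul_apply, Equiv.Perm.mul_apply, adjSwap_lt_iff]
    · exact this
    · rintro ⟨e1, e2⟩
      rw [← e1, ← e2, v, v] at h
      omega
    · rintro ⟨e1, e2⟩
      rw [← e1, ← e2, v, v] at h
      omega

lemma fstar_desc {n : ℕ} (μ : Fin n → ℕ) (k : {i : ℕ // i + 1 < n})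
    (h : μ (hi k) < μ (lo k)) :
    heckeAt k (fstar μ) = fstar (swapEntries (lo k) (hi k) μ) := by
  obtain ⟨hl, hμ⟩ := sortDesc_spec μ
  unfold fstar
  rw [sortDesc_swap, sigmaMin_swap hl hμ k h]
  obtain ⟨h1, h2⟩ := sigmaMin_spec hl hμ
  obtain ⟨w, hw⟩ := exists_reduced (sigmaMin (sortDesc μ) μ)
  have hlt : (sigmaMin (sortDesc μ) μ).symm (lo k) < (sigmaMin (sortDesc μ) μ).symm (hi k) :=
    (good_lt hl h1 h2 _ _).mpr (Or.inl h)
  have hw' : IsReducedWordOf (k :: w) (adjSwap k * sigmaMin (sortDesc μ) μ) := by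
    refine ⟨by rw [List.map_cons, List.prod_cons, hw.1], ?_⟩
    rw [length_up k _ hlt, List.length_cons, hw.2]
  rw [Tsigma_eq hw, Tsigma_eq hw', Tword_cons]

lemma Tword_append {n : ℕ} (w w' : List {i : ℕ // i + 1 < n}) (f : MvPolynomial (Fin n) K) :
    Tword (w ++ w') f = Tword w (Tword w' f) := by
  simp [Tword, List.foldr_append]

lemma hecke_C_mul {n : ℕ} {i j : Fin n} (h : i ≠ j) (c : K) (f : MvPolynomial (Fin n) K) :
    hecke i j (C c * f) = C c * hecke i j f := by
  apply hecke_unique h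
  have e : swapVars i j (C c * f) = C c * swapVars i j f := by simp [swapVars]
  rw [e]
  linear_combination C c * hecke_spec i j f

lemma Tword_C_mul {n : ℕ} (w : List {i : ℕ // i + 1 < n}) (c : K)
    (f : MvPolynomial (Fin n) K) : Tword w (C c * f) = C c * Tword w f := by
  induction w with
  | nil => rfl
  | cons i w ih => rw [Tword_cons, Tword_cons, ih, heckeAt_eq, hecke_C_mul (lo_ne_hi i)]

lemma fstar_eq_case {n : ℕ} (μ : Fin n → ℕ) (k : {i : ℕ // i + 1 < n})
    (h : μ (lo k) = μ (hi k))
    (hE : ∀ (l : Fin n → ℕ) (m : {i : ℕ // i + 1 < n}), l (lo m) = l (hi m) →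
      heckeAt m (Estar l) = C tt * Estar l) :
    heckeAt k (fstar μ) = C tt * fstar μ := by
  obtain ⟨hl, hμ⟩ := sortDesc_spec μ
  unfold fstar
  obtain ⟨h1, h2⟩ := sigmaMin_spec hl hμ
  generalize sigmaMin (sortDesc μ) μ = σ at *
  generalize sortDesc μ = l at *
  obtain ⟨w, hw⟩ := exists_reduced σ
  have hlohi : lo k < hi k := by simp [lo, hi, Fin.lt_def]
  have hlt : σ.symm (lo k) < σ.symm (hi k) :=
    (good_lt hl h1 h2 _ _).mpr (Or.inr ⟨h, hlohi⟩)
  have hx : μ (lo k) = l (σ.symm (lo k)) := by rw [← h1]; rfl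
  have hy : μ (hi k) = l (σ.symm (hi k)) := by rw [← h1]; rfl
  have hle : (σ.symm (lo k)).1 + 1 < n := by
    have := Fin.lt_def.mp hlt; omega
  let m : {i : ℕ // i + 1 < n} := ⟨(σ.symm (lo k)).1, hle⟩
  have em : lo m = σ.symm (lo k) := rfl
  have em' : hi m = σ.symm (hi k) := by
    by_contra hne
    have b1 : hi m < σ.symm (hi k) := by
      apply lt_of_le_of_ne _ hne
      rw [Fin.le_def]; exact hlt
    have b2 : lo m < hi m := by simp [lo, hi, Fin.lt_def]
    have c1 := hl _ _ b1.le
    have c2 := hl _ _ b2.le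
    rw [em] at c2 b2
    have d1 := h2 _ _ b1 (by omega)
    have d2 := h2 _ _ b2 (by omega)
    rw [Equiv.apply_symm_apply] at d1 d2
    rw [Fin.lt_def] at d1 d2
    simp only [lo, hi] at d1 d2
    omega
  have hw' : IsReducedWordOf (k :: w) (adjSwap k * σ) := by
    refine ⟨by rw [List.map_cons, List.prod_cons, hw.1], ?_⟩
    rw [length_up k _ hlt, List.length_cons, hw.2]
  have hw2 : IsReducedWordOf (w ++ [m]) (adjSwap k * σ) := by
    refine ⟨?_, ?_⟩
    · rw [List.map_append, List.prod_append, hw.1, List.map_singleton, List.prod_singleton,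
        adjSwap_eq m, em, em', Equiv.mul_swap_eq_swap_mul, Equiv.apply_symm_apply,
        Equiv.apply_symm_apply, adjSwap_eq]
    · rw [length_up k _ hlt, List.length_append, hw.2, List.length_singleton]
  rw [Tsigma_eq hw, ← Tword_cons, matsumoto _ _ _ hw' hw2, Tword_append]
  have : Tword [m] (Estar l) = C tt * Estar l := by
    apply hE l m
    rw [em, em']; omega
  rw [this, Tword_C_mul]

/-! ### Interpolation -/

/-- The relation counted by `kstat`. -/
def KR {n : ℕ} (ν : Fin n → ℕ) (x y : Fin n) : Prop :=
  (y < x ∧ ν x < ν y) ∨ (x < y ∧ ν x ≤ ν y)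

lemma kstat_eq {n : ℕ} (ν : Fin n → ℕ) (x : Fin n) : kstat ν x = Set.ncard {y | KR ν x y} := by
  unfold kstat
  rw [← Set.ncard_union_eq]
  · rfl
  · rw [Set.disjoint_left]
    rintro y ⟨h1, _⟩ ⟨h2, _⟩
    exact absurd h1 h2.asymm

lemma kstat_congr {n : ℕ} (ν ν' : Fin n → ℕ) (e : Equiv.Perm (Fin n))
    (h : ∀ x y, KR ν x y ↔ KR ν' (e x) (e y)) (x : Fin n) : kstat ν x = kstat ν' (e x) := by
  rw [kstat_eq, kstat_eq, ← Set.ncard_image_of_injective _ e.injective]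
  congr 1
  ext y
  simp only [Set.mem_image, Set.mem_ofPred_eq]
  constructor
  · rintro ⟨z, hz, rfl⟩; exact (h _ _).mp hz
  · intro hy
    exact ⟨e.symm y, (h _ _).mpr (by simpa using hy), by simp⟩

lemma kstat_swap {n : ℕ} (k : {i : ℕ // i + 1 < n}) (ν : Fin n → ℕ)
    (h : ν (lo k) ≠ ν (hi k)) (x : Fin n) :
    kstat (swapEntries (lo k) (hi k) ν) x = kstat ν (adjSwap k x) := by
  apply kstat_congr
  intro x y
  have e : ∀ z, swapEntries (lo k) (hi k) ν z = ν (adjSwap k z) := fun _ => rfl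
  have hlt : lo k < hi k := by simp [lo, hi, Fin.lt_def]
  simp only [KR, e]
  by_cases c1 : x = lo k ∧ y = hi k
  · rw [c1.1, c1.2, adjSwap_lo, adjSwap_hi]
    simp only [hlt, hlt.asymm, true_and, false_and, or_false, false_or]
    omega
  by_cases c2 : x = hi k ∧ y = lo k
  · rw [c2.1, c2.2, adjSwap_lo, adjSwap_hi]
    simp only [hlt, hlt.asymm, true_and, false_and, or_false, false_or]
    omega
  rw [adjSwap_lt_iff k x y c1 c2, adjSwap_lt_iff k y x (fun t => c2 ⟨t.2, t.1⟩)
    (fun t => c1 ⟨t.2, t.1⟩)]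

lemma kstat_adj {n : ℕ} (k : {i : ℕ // i + 1 < n}) (ν : Fin n → ℕ)
    (h : ν (lo k) = ν (hi k)) : kstat ν (lo k) = kstat ν (hi k) + 1 := by
  rw [kstat_eq, kstat_eq, ← Set.ncard_insert_of_notMem (a := hi k) _ (Set.toFinite _)]
  · congr 1
    ext y
    simp only [Set.mem_insert_iff, Set.mem_ofPred_eq, KR, lo, hi, Fin.lt_def, Fin.ext_iff] at *
    by_cases hy : y.1 = k.1 + 1
    · have : y = ⟨k.1 + 1, k.2⟩ := Fin.ext hy
      rw [this]
      simp [h]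
    by_cases hy' : y.1 = k.1
    · have : y = ⟨k.1, by omega⟩ := Fin.ext hy'
      rw [this]
      simp [h]
    rw [h]
    omega
  · simp [KR]

lemma kstat_rot {n : ℕ} (κ : Fin (n + 1) → ℕ) (x : Fin (n + 1)) :
    kstat κ x = kstat (Fin.cons (κ (Fin.last n) + 1) (fun i => κ i.castSucc) : Fin (n + 1) → ℕ)
      (finRotate (n + 1) x) := by
  apply kstat_congr
  intro x y
  have r : ∀ i : Fin n, finRotate (n + 1) i.castSucc = i.succ := by
    intro i; rw [finRotate_apply]; simp
  induction x using Fin.lastCases with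
  | last =>
    induction y using Fin.lastCases with
    | last => simp [KR]
    | cast j =>
      rw [r, finRotate_last]
      simp only [KR, Fin.cons_zero, Fin.cons_succ, Fin.castSucc_lt_last, Fin.succ_pos,
        true_and, (Fin.castSucc_lt_last j).asymm, (Fin.succ_pos j).asymm, false_and, or_false, false_or]
      omega
  | cast i =>
    induction y using Fin.lastCases with
    | last =>
      rw [r, finRotate_last]
      simp only [KR, Fin.cons_zero, Fin.cons_succ, Fin.castSucc_lt_last, Fin.succ_pos,
        true_and, (Fin.castSucc_lt_last i).asymm, (Fin.succ_pos i).asymm, false_and, or_false, false_or]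
      omega
    | cast j =>
      rw [r, r]
      simp only [KR, Fin.cons_succ, Fin.castSucc_lt_castSucc_iff, Fin.succ_lt_succ_iff]

lemma kstat_cons_zero {n : ℕ} (ν : Fin n → ℕ) :
    kstat (Fin.cons 0 ν : Fin (n + 1) → ℕ) 0 = n := by
  rw [kstat_eq]
  have : {y | KR (Fin.cons 0 ν : Fin (n + 1) → ℕ) 0 y} = Set.range Fin.succ := by
    ext y
    simp only [KR, Set.mem_ofPred_eq, Set.mem_range]
    induction y using Fin.cases with
    | zero => simp
    | succ j => simp
  rw [this, ← Set.image_univ, Set.ncard_image_of_injective _ (Fin.succ_injective n),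
    Set.ncard_univ]
  simp

lemma kstat_cons_succ {n : ℕ} (ν : Fin n → ℕ) (i : Fin n) :
    kstat (Fin.cons 0 ν : Fin (n + 1) → ℕ) i.succ = kstat ν i := by
  rw [kstat_eq, kstat_eq, ← Set.ncard_image_of_injective _ (Fin.succ_injective n)]
  congr 1
  ext y
  simp only [KR, Set.mem_ofPred_eq, Set.mem_image]
  induction y using Fin.cases with
  | zero => simp
  | succ j => simp

lemma qt_inj {a b c d : ℕ} (h : qq ^ a * tt ^ b = qq ^ c * tt ^ d) : a = c ∧ b = d := by
  unfold qq tt at h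
  rw [← map_pow, ← map_pow, ← map_pow, ← map_pow, ← map_mul, ← map_mul] at h
  have h2 := IsFractionRing.injective (MvPolynomial (Fin 2) ℚ) K h
  rw [X_pow_eq_monomial, X_pow_eq_monomial, X_pow_eq_monomial, X_pow_eq_monomial,
    monomial_mul, monomial_mul, one_mul] at h2
  have h3 := monomial_left_injective (one_ne_zero) h2
  have h4 := DFunLike.congr_fun h3 0
  have h5 := DFunLike.congr_fun h3 1
  simp at h4 h5
  exact ⟨h4, h5⟩

lemma qq_ne : qq ≠ 0 := by
  intro h
  have := (qt_inj (a := 1) (b := 0) (c := 2) (d := 0) (by rw [h]; simp)).1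
  omega

lemma tt_ne : tt ≠ 0 := by
  intro h
  have := (qt_inj (a := 0) (b := 1) (c := 0) (d := 2) (by rw [h]; simp)).2
  omega

lemma qt_inj' {a b c d : ℕ} (h : qq ^ a * tt ^ (-(b : ℤ)) = qq ^ c * tt ^ (-(d : ℤ))) :
    a = c ∧ b = d := by
  have ht := tt_ne
  have h2 : qq ^ a * tt ^ d = qq ^ c * tt ^ b := by
    rw [zpow_neg, zpow_neg, zpow_natCast, zpow_natCast] at h
    field_simp at h
    linear_combination h
  have := qt_inj h2
  exact ⟨this.1, this.2.symm⟩

lemma evalPt_cons_zero {n : ℕ} (ν : Fin n → ℕ) :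
    evalPt (Fin.cons 0 ν : Fin (n + 1) → ℕ) = Fin.cons (tt ^ (-(n : ℤ))) (evalPt ν) := by
  funext x
  induction x using Fin.cases with
  | zero => simp [evalPt, kstat_cons_zero]
  | succ i => simp [evalPt, kstat_cons_succ]

lemma evalPt_rot {n : ℕ} (κ : Fin (n + 1) → ℕ) :
    evalPt (Fin.cons (κ (Fin.last n) + 1) (fun i => κ i.castSucc) : Fin (n + 1) → ℕ) =
      Fin.cons (qq * evalPt κ (Fin.last n)) (fun i => evalPt κ i.castSucc) := by
  have r : ∀ i : Fin n, finRotate (n + 1) i.castSucc = i.succ := by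
    intro i; rw [finRotate_apply]; simp
  funext x
  induction x using Fin.cases with
  | zero =>
    have := kstat_rot κ (Fin.last n)
    rw [finRotate_last] at this
    simp only [evalPt, Fin.cons_zero, this]
    ring
  | succ i =>
    have := kstat_rot κ i.castSucc
    rw [r] at this
    simp only [evalPt, Fin.cons_succ, this]

lemma eval_aeval' {n m : ℕ} (F : Fin n → MvPolynomial (Fin m) K) (x : Fin m → K)
    (f : MvPolynomial (Fin n) K) :
    eval x (aeval F f) = eval (fun i => eval x (F i)) f := by
  induction f using MvPolynomial.induction_on with
  | C a => simp
  | add p q hp hq => rw [map_add, map_add, map_add, hp, hq]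
  | mul_X p k hp => rw [map_mul, map_mul, map_mul, hp, aeval_X, eval_X]

lemma totalDegree_aeval' {n m : ℕ} (F : Fin n → MvPolynomial (Fin m) K)
    (hF : ∀ i, (F i).totalDegree ≤ 1) (f : MvPolynomial (Fin n) K) :
    (aeval F f).totalDegree ≤ f.totalDegree := by
  rw [aeval_def, eval₂_eq]
  apply totalDegree_finsetSum_le
  intro d hd
  refine (totalDegree_mul _ _).trans ?_
  rw [algebraMap_eq, totalDegree_C, zero_add]
  refine (totalDegree_finsetProd _ _).trans ?_
  refine le_trans ?_ (le_totalDegree hd)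
  rw [Finsupp.sum]
  apply Finset.sum_le_sum
  intro i _
  refine (totalDegree_pow _ _).trans ?_
  calc d i * (F i).totalDegree ≤ d i * 1 := Nat.mul_le_mul_left _ (hF i)
    _ = d i := mul_one _

lemma deg_X_sub_C {n : ℕ} (i : Fin n) (c : K) :
    1 ≤ (X i - C c : MvPolynomial (Fin n) K).totalDegree := by
  have h : (Finsupp.single i 1) ∈ (X i - C c : MvPolynomial (Fin n) K).support := by
    have e : (0 : Fin n →₀ ℕ) ≠ Finsupp.single i 1 := by
      intro e; simpa using DFunLike.congr_fun e i
    simp [mem_support_iff, coeff_sub, coeff_X, coeff_C, e]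
  simpa using le_totalDegree h

lemma deg_X_sub_X {n : ℕ} {i j : Fin n} (hij : i ≠ j) :
    1 ≤ (X i - X j : MvPolynomial (Fin n) K).totalDegree := by
  have h : (Finsupp.single i 1) ∈ (X i - X j : MvPolynomial (Fin n) K).support := by
    have e : (Finsupp.single j 1 : Fin n →₀ ℕ) ≠ Finsupp.single i 1 := by
      intro e
      have := DFunLike.congr_fun e i
      simp [Finsupp.single_apply, hij.symm] at this
    simp [mem_support_iff, coeff_sub, coeff_X, e]
  simpa using le_totalDegree h

lemma exists_div_C {n : ℕ} (c : K) (f : MvPolynomial (Fin (n + 1)) K) :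
    ∃ g, f - rename Fin.succ
      (aeval (Fin.cons (C c) X : Fin (n + 1) → MvPolynomial (Fin n) K) f) = (X 0 - C c) * g := by
  induction f using MvPolynomial.induction_on with
  | C a => exact ⟨0, by simp⟩
  | add p q hp hq =>
    obtain ⟨g, hg⟩ := hp
    obtain ⟨h, hh⟩ := hq
    refine ⟨g + h, ?_⟩
    rw [map_add, map_add]
    linear_combination hg + hh
  | mul_X p k hp =>
    obtain ⟨g, hg⟩ := hp
    rw [map_mul, map_mul, aeval_X]
    induction k using Fin.cases with
    | zero =>
      refine ⟨g * C c + p, ?_⟩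
      rw [Fin.cons_zero, rename_C]
      linear_combination C c * hg
    | succ k =>
      refine ⟨g * X k.succ, ?_⟩
      rw [Fin.cons_succ, rename_X]
      linear_combination X k.succ * hg

lemma interp {n : ℕ} (d : ℕ) (f : MvPolynomial (Fin n) K) (hdeg : f.totalDegree ≤ d)
    (h : ∀ ν : Fin n → ℕ, csize ν ≤ d → eval (evalPt ν) f = 0) : f = 0 := by
  induction n generalizing d with
  | zero =>
    have := h Fin.elim0 (by simp [csize])
    rw [eq_C_of_isEmpty f] at this ⊢
    simpa using this
  | succ n ihn =>
    induction d generalizing f with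
    | zero =>
      rw [totalDegree_eq_zero_iff_eq_C.mp (Nat.le_zero.mp hdeg)] at h ⊢
      have := h 0 (by simp [csize])
      simpa using this
    | succ d ihd =>
      have h0 : aeval (Fin.cons (C (tt ^ (-(n : ℤ)))) X : Fin (n + 1) → MvPolynomial (Fin n) K)
          f = 0 := by
        apply ihn (d + 1)
        · refine (totalDegree_aeval' _ ?_ f).trans hdeg
          intro i
          induction i using Fin.cases with
          | zero => simp
          | succ i => simp
        · intro ν hν
          rw [eval_aeval']
          have := h (Fin.cons 0 ν) (by simpa [csize, Fin.sum_univ_succ] using hν)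
          rw [evalPt_cons_zero] at this
          convert this using 2
          congr 1
          funext i
          induction i using Fin.cases with
          | zero => simp
          | succ i => simp
      obtain ⟨g, hg⟩ := exists_div_C (tt ^ (-(n : ℤ))) f
      rw [h0, map_zero, sub_zero] at hg
      by_cases hg0 : g = 0
      · rw [hg, hg0, mul_zero]
      have hX := deg_X_sub_C (0 : Fin (n + 1)) (tt ^ (-(n : ℤ)))
      have hX0 : (X 0 - C (tt ^ (-(n : ℤ))) : MvPolynomial (Fin (n + 1)) K) ≠ 0 := by
        intro e; rw [e] at hX; simp at hX
      have hdg : g.totalDegree ≤ d := by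
        rw [hg, totalDegree_mul_of_isDomain hX0 hg0] at hdeg
        omega
      have h1 : aeval (Fin.cons (C qq * X (Fin.last n)) (fun i => X i.castSucc) :
          Fin (n + 1) → MvPolynomial (Fin (n + 1)) K) g = 0 := by
        apply ihd
        · refine (totalDegree_aeval' _ ?_ g).trans hdg
          intro i
          induction i using Fin.cases with
          | zero =>
            rw [Fin.cons_zero]
            refine (totalDegree_mul _ _).trans ?_
            simp
          | succ i => simp
        · intro κ hκ
          have := h (Fin.cons (κ (Fin.last n) + 1) (fun i => κ i.castSucc)) (by
            simp only [csize, Fin.sum_univ_succ (n := n), Fin.cons_zero, Fin.cons_succ]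
            simp only [csize, Fin.sum_univ_castSucc] at hκ
            omega)
          rw [hg, map_mul] at this
          rcases mul_eq_zero.mp this with h2 | h2
          · exfalso
            rw [map_sub, eval_X, eval_C, sub_eq_zero] at h2
            unfold evalPt at h2
            have h4 : tt ^ (-(n : ℤ)) = qq ^ 0 * tt ^ (-(n : ℤ)) := by rw [pow_zero, one_mul]
            have h3 := (qt_inj' (h2.trans h4)).1
            rw [Fin.cons_zero] at h3
            omega
          · rw [evalPt_rot] at h2
            rw [eval_aeval']
            convert h2 using 2
            congr 1
            funext i
            induction i using Fin.cases with
            | zero => simp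
            | succ i => simp
      exfalso
      apply hg0
      have h2 := congrArg (aeval (Fin.snoc (fun i => X i.succ) (C qq⁻¹ * X 0) :
          Fin (n + 1) → MvPolynomial (Fin (n + 1)) K)) h1
      rw [map_zero, ← AlgHom.comp_apply, comp_aeval] at h2
      rw [← h2]
      conv_lhs => rw [← aeval_X_left_apply (R := K) g]
      congr 2
      funext i
      induction i using Fin.cases with
      | zero =>
        simp only [Fin.cons_zero, map_mul, aeval_X, Fin.snoc_last, algHom_C, algebraMap_eq]
        rw [← mul_assoc, ← C_mul, mul_inv_cancel₀ qq_ne, C_1, one_mul]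
      | succ i => simp

lemma Estar_sym {n : ℕ} (l : Fin n → ℕ) (m : {i : ℕ // i + 1 < n}) (hm : l (lo m) = l (hi m)) :
    heckeAt m (Estar l) = C tt * Estar l := by
  by_cases hex : ∃ f, IsEstar l f
  swap
  · unfold Estar
    rw [dif_neg hex, mul_zero, heckeAt_eq]
    apply hecke_unique (lo_ne_hi m)
    simp [swapVars]
  have hE : IsEstar l (Estar l) := by
    unfold Estar
    rw [dif_pos hex]
    exact hex.choose_spec
  generalize Estar l = f at hE
  obtain ⟨hdeg, -, hv⟩ := hE
  rw [← sub_eq_zero]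
  have spec := hecke_spec (lo m) (hi m) f
  rw [← heckeAt_eq] at spec
  have hne := lo_ne_hi m
  have spec2 : (X (lo m) - X (hi m)) * (heckeAt m f - C tt * f) =
      - ((C tt * X (lo m) - X (hi m)) * (f - swapVars (lo m) (hi m) f)) := by
    linear_combination spec
  apply interp (csize l)
  · by_cases h0 : heckeAt m f - C tt * f = 0
    · rw [h0]; simp
    have h1 := congrArg totalDegree spec2
    rw [totalDegree_mul_of_isDomain (X_sub_X_ne hne) h0, totalDegree_neg] at h1
    have h2 := totalDegree_mul (C tt * X (lo m) - X (hi m)) (f - swapVars (lo m) (hi m) f)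
    have h3 : (C tt * X (lo m) - X (hi m) : MvPolynomial (Fin n) K).totalDegree ≤ 1 := by
      refine (totalDegree_sub _ _).trans (max_le ?_ (by simp))
      refine (totalDegree_mul _ _).trans ?_
      simp
    have h4 : (f - swapVars (lo m) (hi m) f).totalDegree ≤ csize l :=
      (totalDegree_sub _ _).trans (max_le hdeg ((totalDegree_rename_le _ _).trans hdeg))
    have h5 := deg_X_sub_X hne
    omega
  · intro ν hν
    have h1 := congrArg (eval (evalPt ν)) spec2
    simp only [map_mul, map_sub, map_neg, eval_X, eval_C] at h1 ⊢
    have hsw : eval (evalPt ν) (swapVars (lo m) (hi m) f) =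
        eval (evalPt ν ∘ adjSwap m) f := by
      unfold swapVars
      rw [eval_rename]; rfl
    rw [hsw] at h1
    by_cases hνe : ν (lo m) = ν (hi m)
    · have hk := kstat_adj m ν hνe
      have ht := tt_ne
      have e1 : evalPt ν (hi m) = tt * evalPt ν (lo m) := by
        simp only [evalPt, hk, hνe, zpow_neg, zpow_natCast, pow_succ]
        field_simp
      have e2 : evalPt ν (lo m) - evalPt ν (hi m) ≠ 0 := by
        intro e
        have := (qt_inj' (sub_eq_zero.mp e)).2
        omega
      rw [e1, sub_self, zero_mul, neg_zero] at h1
      rw [e1] at e2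
      exact (mul_eq_zero.mp h1).resolve_left e2
    · have e2 : evalPt ν (lo m) - evalPt ν (hi m) ≠ 0 := by
        intro e
        exact hνe (qt_inj' (sub_eq_zero.mp e)).1
      have hpt : evalPt ν ∘ adjSwap m = evalPt (swapEntries (lo m) (hi m) ν) := by
        funext x
        simp only [evalPt, Function.comp_apply, kstat_swap m ν hνe]
        rfl
      have hcs : csize (swapEntries (lo m) (hi m) ν) = csize ν :=
        Equiv.sum_comp (Equiv.swap (lo m) (hi m)) ν
      have n1 : ν ≠ l := by rintro rfl; exact hνe hm
      have n2 : swapEntries (lo m) (hi m) ν ≠ l := by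
        rintro rfl
        simp only [swapEntries, Function.comp_apply, Equiv.swap_apply_left,
          Equiv.swap_apply_right] at hm
        exact hνe hm.symm
      rw [hpt, hv ν hν n1, hv _ (by rw [hcs]; exact hν) n2] at h1
      rw [hv ν hν n1]
      rw [sub_self, mul_zero, mul_zero, neg_zero] at h1
      rw [mul_zero]
      exact (mul_eq_zero.mp h1).resolve_left e2

/-! ### Final assembly -/

lemma fstar_main {n : ℕ} (μ : Fin n → ℕ) (k : {i : ℕ // i + 1 < n}) :
    (μ (lo k) > μ (hi k) → heckeAt k (fstar μ) = fstar (swapEntries (lo k) (hi k) μ)) ∧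
    (μ (lo k) = μ (hi k) → heckeAt k (fstar μ) = C tt * fstar μ) ∧
    (μ (lo k) < μ (hi k) → heckeAt k (fstar μ) =
      C tt * fstar (swapEntries (lo k) (hi k) μ) - C (1 - tt) * fstar μ) := by
  refine ⟨fstar_desc μ k, fun h => fstar_eq_case μ k h Estar_sym, fun h => ?_⟩
  have h1 := fstar_desc (swapEntries (lo k) (hi k) μ) k (by
    simp only [swapEntries, Function.comp_apply, Equiv.swap_apply_left, Equiv.swap_apply_right]
    exact h)
  rw [swapEntries_swapEntries] at h1
  rw [← h1, heckeAt_eq, hecke_quad (lo_ne_hi k)]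
  simp only [map_sub, map_one]
  ring

lemma hecke_scale {n : ℕ} {i j : Fin n} (hij : i ≠ j) (f : MvPolynomial (Fin n) K) :
    hecke i j (scaleQinv f) = scaleQinv (hecke i j f) := by
  apply hecke_unique hij
  have hs : swapVars i j (scaleQinv f) = scaleQinv (swapVars i j f) := by
    unfold swapVars scaleQinv
    induction f using MvPolynomial.induction_on with
    | C a => simp
    | add p q hp hq => rw [map_add, map_add, map_add, map_add, hp, hq]
    | mul_X p k hp =>
      rw [map_mul, map_mul, map_mul, map_mul, hp, aeval_X, rename_X, aeval_X, map_mul,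
        rename_C, rename_X]
  have h := congrArg scaleQinv (hecke_spec i j f)
  rw [hs]
  have hC : (C qq⁻¹ : MvPolynomial (Fin n) K) ≠ 0 := by
    rw [Ne, C_eq_zero]; exact inv_ne_zero qq_ne
  apply mul_left_cancel₀ hC
  unfold scaleQinv at *
  simp only [map_mul, map_sub, aeval_X, algHom_C, algebraMap_eq] at h
  linear_combination h

lemma csize_swap {n : ℕ} (i j : Fin n) (μ : Fin n → ℕ) :
    csize (swapEntries i j μ) = csize μ := Equiv.sum_comp (Equiv.swap i j) μ

/-- Hecke action on the polynomials `f̂*_μ`. -/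
theorem statement14 (n : ℕ) (μ : Fin n → ℕ) (i j : Fin n) (hij : (j : ℕ) = (i : ℕ) + 1) :
    (μ i > μ j → hecke i j (fstarHat μ) = fstarHat (swapEntries i j μ)) ∧
    (μ i = μ j → hecke i j (fstarHat μ) = C tt * fstarHat μ) ∧
    (μ i < μ j →
      hecke i j (fstarHat μ) =
        C tt * fstarHat (swapEntries i j μ) - C (1 - tt) * fstarHat μ) := by
  have hne : i ≠ j := by rintro rfl; omega
  have key : hecke i j (fstarHat μ) = C (qq ^ csize μ) * scaleQinv (hecke i j (fstar μ)) := by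
    unfold fstarHat
    rw [hecke_C_mul hne, hecke_scale hne]
  have hlt : i.1 + 1 < n := by rw [← hij]; exact j.2
  have e1 : lo ⟨i.1, hlt⟩ = i := rfl
  have e2 : hi ⟨i.1, hlt⟩ = j := Fin.ext hij.symm
  have main := fstar_main μ ⟨i.1, hlt⟩
  rw [heckeAt_eq, e1, e2] at main
  obtain ⟨m1, m2, m3⟩ := main
  rw [key]
  unfold fstarHat
  rw [csize_swap]
  refine ⟨fun h => by rw [m1 h], fun h => ?_, fun h => ?_⟩
  · rw [m2 h]
    simp only [scaleQinv, map_mul, algHom_C, algebraMap_eq]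
    ring
  · rw [m3 h]
    simp only [scaleQinv, map_mul, map_sub, algHom_C, algebraMap_eq]
    ring
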